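/- Let n ≥ 1, let F : ℝⁿ → ℝⁿ be a C^∞ vector field, and let φ : ℝⁿ × ℝ → ℝⁿ be a C^∞ map satisfying φ(z,0) = z, φ(φ(z,s),t) = φ(z,s+t), and (∂φ/∂t)(z,t) = F(φ(z,t)) for all z ∈ ℝⁿ and s,t ∈ ℝ (i.e. φ is the flow of F). Suppose z₀ ∈ ℝⁿ is a zero of F, i.e. F(z₀) = 0. Then for every C^∞ function α : ℝⁿ → ℝ, the map h : ℝⁿ → ℝⁿ defined by h(z) = φ(z, α(z)) satisfies Dh(z₀) = exp(α(z₀)·DF(z₀)), where Dh(z₀) and DF(z₀) are the Fréchet derivatives (Jacobian matrices) at z₀ and exp denotes the matrix (operator) exponential. -/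

import Mathlib

section Flow

variable {E : Type*} [NormedAddCommGroup E] [NormedSpace ℝ E]

/-- The solution of the linear differential equation `P' = A * P` with `P 0 = 1` is
`t ↦ exp (t • A)`. -/
theorem eq_exp_smul_of_hasDerivAt_mul {R : Type*} [NormedRing R] [NormedAlgebra ℝ R]
    [CompleteSpace R] {A : R} {P : ℝ → R} (hP : ∀ t, HasDerivAt P (A * P t) t) (hP0 : P 0 = 1)
    (t : ℝ) : P t = NormedSpace.exp (t • A) := by
  let _ : NormedAlgebra ℚ R := NormedAlgebra.restrictScalars ℚ ℝ R
  have hQ : ∀ s, HasDerivAt (fun u : ℝ => NormedSpace.exp (u • -A) * P u) 0 s := fun s => by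
    refine ((hasDerivAt_exp_smul_const (𝕂 := ℝ) (-A) s).mul (hP s)).congr_deriv ?_
    simp [mul_assoc]
  have hconst : NormedSpace.exp (t • -A) * P t = 1 := by
    have := is_const_of_deriv_eq_zero (fun s => (hQ s).differentiableAt)
      (fun s => (hQ s).deriv) t 0
    simpa [hP0] using this
  have hinv : NormedSpace.exp (t • A) * NormedSpace.exp (t • -A) = 1 := by
    rw [← NormedSpace.exp_add_of_commute]
    · simp
    · exact (Commute.refl A).neg_right.smul_left t |>.smul_right t
  calc P t = NormedSpace.exp (t • A) * NormedSpace.exp (t • -A) * P t := by rw [hinv, one_mul]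
    _ = NormedSpace.exp (t • A) := by rw [mul_assoc, hconst, mul_one]

/-- The derivative of a flow in the direction of time is the generating vector field. -/
theorem fderiv_flow_apply_time {F : E → E} {φ : E → ℝ → E}
    (hφ : Differentiable ℝ (fun p : E × ℝ => φ p.1 p.2))
    (hφF : ∀ z t, HasDerivAt (φ z) (F (φ z t)) t) (p : E × ℝ) :
    fderiv ℝ (fun p : E × ℝ => φ p.1 p.2) p (0, 1) = F (φ p.1 p.2) := by
  have hc : HasDerivAt (fun s : ℝ => (p.1, s)) ((0 : E), (1 : ℝ)) p.2 :=
    (hasDerivAt_const p.2 p.1).prodMk (hasDerivAt_id p.2)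
  have hcomp := HasFDerivAt.comp_hasDerivAt p.2 (hφ (p.1, p.2)).hasFDerivAt hc
  exact hcomp.unique (hφF p.1 p.2)

/-- A zero of a vector field is a fixed point of its flow. -/
theorem flow_eq_self_of_eq_zero {F : E → E} {φ : E → ℝ → E}
    (hφ : Differentiable ℝ (fun p : E × ℝ => φ p.1 p.2))
    (hφ0 : ∀ z, φ z 0 = z) (hφadd : ∀ z s t, φ (φ z s) t = φ z (s + t))
    (hφF : ∀ z t, HasDerivAt (φ z) (F (φ z t)) t) {z₀ : E} (hz₀ : F z₀ = 0) (t : ℝ) :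
    φ z₀ t = z₀ := by
  have hF : ∀ t, F (φ z₀ t) = 0 := fun t => by
    have h1 : HasDerivAt (φ z₀) 0 0 := by simpa [hφ0, hz₀] using hφF z₀ 0
    have hcomp := HasFDerivAt.comp_hasDerivAt (0 : ℝ) (hφ (φ z₀ 0, t)).hasFDerivAt
      (h1.prodMk (hasDerivAt_const 0 t))
    have h2 : HasDerivAt (fun s : ℝ => φ (φ z₀ s) t) 0 0 := hcomp.congr_deriv (map_zero _)
    have h3 : HasDerivAt (fun s : ℝ => φ z₀ (s + t)) (F (φ z₀ t)) 0 :=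
      HasDerivAt.comp_add_const 0 t (by simpa using hφF z₀ t)
    simp only [hφadd] at h2
    exact h3.unique h2
  have := is_const_of_deriv_eq_zero (fun s => (hφF z₀ s).differentiableAt)
    (fun s => (hφF z₀ s).deriv.trans (hF s)) t 0
  rw [this, hφ0]

/-- The spatial derivative of a flow satisfies the variational equation. -/
theorem hasDerivAt_fderiv_flow_comp_inl {F : E → E} (hF : Differentiable ℝ F) {φ : E → ℝ → E}
    (hφ : ContDiff ℝ 2 (fun p : E × ℝ => φ p.1 p.2))
    (hφF : ∀ z t, HasDerivAt (φ z) (F (φ z t)) t) (z : E) (t : ℝ) :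
    HasDerivAt
      (fun s => (fderiv ℝ (fun p : E × ℝ => φ p.1 p.2) (z, s)).comp (.inl ℝ E ℝ))
      ((fderiv ℝ F (φ z t)).comp
        ((fderiv ℝ (fun p : E × ℝ => φ p.1 p.2) (z, t)).comp (.inl ℝ E ℝ))) t := by
  have hd := hφ.differentiable two_ne_zero
  have htime := fderiv_flow_apply_time hd hφF
  have hsymm : IsSymmSndFDerivAt ℝ (fun p : E × ℝ => φ p.1 p.2) (z, t) :=
    hφ.contDiffAt.isSymmSndFDerivAt (by simp)
  set G : E × ℝ → E := fun p => φ p.1 p.2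
  have hG' : HasFDerivAt (fderiv ℝ G) (fderiv ℝ (fderiv ℝ G) (z, t)) (z, t) :=
    ((hφ.fderiv_right (m := 1) (by norm_num)).differentiable one_ne_zero _).hasFDerivAt
  have hc : HasDerivAt (fun s : ℝ => (z, s)) ((0 : E), (1 : ℝ)) t :=
    (hasDerivAt_const t z).prodMk (hasDerivAt_id t)
  refine ((hG'.comp_hasDerivAt t hc).clm_comp
    (hasDerivAt_const t (ContinuousLinearMap.inl ℝ E ℝ))).congr_deriv ?_
  have h1 : HasFDerivAt (fun p => fderiv ℝ G p (0, 1))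
      ((fderiv ℝ F (G (z, t))).comp (fderiv ℝ G (z, t))) (z, t) := by
    simp only [htime]
    exact (hF (G (z, t))).hasFDerivAt.comp (z, t) (hd (z, t)).hasFDerivAt
  have h2 := h1.unique (hG'.clm_apply (hasFDerivAt_const ((0 : E), (1 : ℝ)) (z, t)))
  ext v
  have h3 := DFunLike.congr_fun h2 (v, (0 : ℝ))
  have h4 := hsymm.eq (0, 1) (v, 0)
  simp only [ContinuousLinearMap.comp_apply, ContinuousLinearMap.flip_apply, zero_add,
    add_zero, ContinuousLinearMap.comp_zero, ContinuousLinearMap.inl_apply] at h3 ⊢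
  rw [h4, ← h3]

end Flow

/-- if `z₀` is a zero of the vector field `F` with flow `φ`, and
`h(z) = φ(z, α(z))`, then `Dh(z₀) = exp(α(z₀)·DF(z₀))`. -/
theorem fderiv_shift_at_singular_point
    (n : ℕ) (hn : 1 ≤ n)
    (F : EuclideanSpace ℝ (Fin n) → EuclideanSpace ℝ (Fin n))
    (hF : ContDiff ℝ (⊤ : ℕ∞) F)
    (φ : EuclideanSpace ℝ (Fin n) → ℝ → EuclideanSpace ℝ (Fin n))
    (hφ : ContDiff ℝ (⊤ : ℕ∞) (fun p : EuclideanSpace ℝ (Fin n) × ℝ => φ p.1 p.2))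
    (hφ0 : ∀ z, φ z 0 = z)
    (hφadd : ∀ z s t, φ (φ z s) t = φ z (s + t))
    (hφF : ∀ z t, HasDerivAt (φ z) (F (φ z t)) t)
    (z₀ : EuclideanSpace ℝ (Fin n)) (hz₀ : F z₀ = 0)
    (α : EuclideanSpace ℝ (Fin n) → ℝ) (hα : ContDiff ℝ (⊤ : ℕ∞) α)
    (h : EuclideanSpace ℝ (Fin n) → EuclideanSpace ℝ (Fin n))
    (hh : ∀ z, h z = φ z (α z)) :
    fderiv ℝ h z₀ = NormedSpace.exp (α z₀ • fderiv ℝ F z₀) := by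
  have hd := hφ.differentiable (by simp)
  have hφ2 : ContDiff ℝ 2 (fun p : EuclideanSpace ℝ (Fin n) × ℝ => φ p.1 p.2) :=
    hφ.of_le (WithTop.coe_le_coe.2 le_top)
  have hfix := flow_eq_self_of_eq_zero hd hφ0 hφadd hφF hz₀
  have htime := fderiv_flow_apply_time hd hφF (z₀, α z₀)
  rw [hfix, hz₀] at htime
  have hexp := eq_exp_smul_of_hasDerivAt_mul (A := fderiv ℝ F z₀)
    (fun t => by
      have hvar := hasDerivAt_fderiv_flow_comp_inl (hF.differentiable (by simp)) hφ2 hφF z₀ t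
      rwa [hfix] at hvar)
    (by
      have hinl := HasFDerivAt.comp z₀ (hd (z₀, 0)).hasFDerivAt
        (hasFDerivAt_prodMk_left (𝕜 := ℝ) z₀ (0 : ℝ))
      refine hinl.unique ((hasFDerivAt_id z₀).congr_of_eventuallyEq ?_)
      exact .of_forall hφ0) (α z₀)
  obtain rfl : h = fun z => φ z (α z) := funext hh
  have hchain := HasFDerivAt.comp z₀ (hd (z₀, α z₀)).hasFDerivAt
    ((hasFDerivAt_id z₀).prodMk ((hα.differentiable (by simp)) z₀).hasFDerivAt)
  rw [← hexp]
  refine hchain.fderiv.trans ?_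
  ext1 v
  have hsplit : (v, fderiv ℝ α z₀ v) = (v, (0 : ℝ)) + fderiv ℝ α z₀ v • (0, 1) := by simp
  simp only [ContinuousLinearMap.comp_apply, ContinuousLinearMap.prod_apply,
    ContinuousLinearMap.id_apply, ContinuousLinearMap.inl_apply]
  rw [hsplit, map_add, map_smul, htime, smul_zero, add_zero]
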